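/- Let g : [−1,1] → ℝ be measurable with |g(x)| ≤ 1 for all x ∈ [−1,1], let k ∈ ℕ, let ω_min < ω_max be real numbers, and let 0 < ε < 1. Set C := (1/4)·√((e + e⁻¹)² − 4) = (e − e⁻¹)/4 and M₀ := 2·exp(C·(ω_max − ω_min)). Then for every natural number N with N ≥ ln(4 M₀/(e − 1)) + ln(1/ε), there exists a real polynomial p of degree at most N such that sup_{ω ∈ [−1,1]} | ∫_{−1}^{1} T_k(x) cos(χ(ω) g(x)) dx − p(ω) | ≤ ε, where χ(ω) = ((ω_max − ω_min)/2)·ω + (ω_max + ω_min)/2 is the affine map from [−1,1] onto [ω_min, ω_max]. Equivalently, the function ω ↦ ∫_{−1}^{1} T_k(x) cos(ω g(x)) dx can be approximated uniformly on [ω_min, ω_max] to accuracy ε by a polynomial of degree at most N. -/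

import Mathlib

open Set Polynomial

open scoped Real

lemma fourier_integral_eq_circleIntegral (f : ℂ → ℂ) (n : ℕ) :
    (∮ z in C(0, 1), (z ^ (n + 1))⁻¹ * f ((z + z⁻¹) / 2)) =
      Complex.I * ∫ x in (0 : ℝ)..2 * π, Complex.exp (-(n * x * Complex.I)) * f (Real.cos x) := by
  rw [circleIntegral, ← intervalIntegral.integral_const_mul]
  refine intervalIntegral.integral_congr fun x _ => ?_
  have h0 : Complex.exp (x * Complex.I) ≠ 0 := Complex.exp_ne_zero _
  simp only [deriv_circleMap, circleMap, Complex.ofReal_one, one_mul, zero_add, smul_eq_mul]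
  have h1 : (Complex.exp (x * Complex.I) + (Complex.exp (x * Complex.I))⁻¹) / 2
      = (Real.cos x : ℂ) := by
    rw [Complex.ofReal_cos, Complex.cos, ← Complex.exp_neg, neg_mul]
  have h2 : Complex.exp (-(n * x * Complex.I)) = (Complex.exp (x * Complex.I) ^ n)⁻¹ := by
    rw [← Complex.exp_nat_mul, ← Complex.exp_neg, mul_assoc]
  rw [h1, h2, pow_succ]
  field_simp

lemma norm_fourier_integral_le {f : ℂ → ℂ} (hf : Differentiable ℂ f) {ρ M : ℝ} (hρ : 1 < ρ)
    (hM : ∀ z : ℂ, ‖z‖ = ρ → ‖f ((z + z⁻¹) / 2)‖ ≤ M) (n : ℕ) :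
    ‖∫ x in (0 : ℝ)..2 * π, Complex.exp (-(n * x * Complex.I)) * f (Real.cos x)‖
      ≤ 2 * π * (M * (ρ⁻¹) ^ n) := by
  have hd : ∀ z : ℂ, z ≠ 0 →
      DifferentiableAt ℂ (fun z : ℂ => (z ^ (n + 1))⁻¹ * f ((z + z⁻¹) / 2)) z := by
    intro z hz
    have h1 : DifferentiableAt ℂ (fun z : ℂ => (z ^ (n + 1))⁻¹) z :=
      (differentiableAt_id.pow (n + 1)).inv (pow_ne_zero _ hz)
    exact h1.mul ((hf _).comp z
      ((differentiableAt_id.add (differentiableAt_id.inv hz)).div_const 2))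
  have hdef := Complex.circleIntegral_eq_of_differentiable_on_annulus_off_countable
    (c := 0) one_pos hρ.le
    (f := fun z : ℂ => (z ^ (n + 1))⁻¹ * f ((z + z⁻¹) / 2)) countable_empty
    (fun z hz => (hd z (by
      rintro rfl
      simp at hz)).continuousAt.continuousWithinAt)
    (fun z hz => hd z (by
      rintro rfl
      simp at hz))
  have hρ0 : 0 < ρ := by linarith
  have hb := circleIntegral.norm_integral_le_of_norm_le_const (c := 0) hρ0.le
    (f := fun z : ℂ => (z ^ (n + 1))⁻¹ * f ((z + z⁻¹) / 2)) (C := (ρ ^ (n + 1))⁻¹ * M)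
    (fun z hz => by
      have hz' : ‖z‖ = ρ := by simpa using hz
      rw [norm_mul, norm_inv, norm_pow, hz']
      exact mul_le_mul_of_nonneg_left (hM z hz') (by positivity))
  rw [hdef, fourier_integral_eq_circleIntegral, norm_mul, Complex.norm_I, one_mul] at hb
  refine hb.trans (le_of_eq ?_)
  rw [pow_succ, inv_pow]
  field_simp

/-- Bernstein's theorem on truncated Chebyshev expansions: if `f` is bounded by `M` on the Bernstein
ellipse with parameter `ρ`, then on `[-1, 1]` its real part is within `2 M ρ⁻ᴺ / (ρ - 1)` of
a polynomial of degree at most `N`. -/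
theorem exists_polynomial_abs_re_sub_le_of_bernstein_ellipse {f : ℂ → ℂ} (hf : Differentiable ℂ f)
    {ρ M : ℝ} (hρ : 1 < ρ) (hM : ∀ z : ℂ, ‖z‖ = ρ → ‖f ((z + z⁻¹) / 2)‖ ≤ M) (N : ℕ) :
    ∃ p : ℝ[X], p.natDegree ≤ N ∧
      ∀ ω ∈ Icc (-1 : ℝ) 1, |(f ω).re - p.eval ω| ≤ 2 * M * (ρ⁻¹) ^ N / (ρ - 1) := by
  have hT : Fact (0 < 2 * π) := ⟨by positivity⟩
  have hρ0 : 0 < ρ := by linarith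
  let H : C(AddCircle (2 * π), ℂ) :=
    ⟨fun t => f ((fourier 1 t + fourier (-1) t) / 2), by
      have := hf.continuous
      fun_prop⟩
  have hexp (n : ℤ) (x : ℝ) : fourier n (x : AddCircle (2 * π)) =
      Complex.exp (n * x * Complex.I) := by
    rw [fourier_coe_apply]
    congr 1
    have : (π : ℂ) ≠ 0 := by exact_mod_cast Real.pi_ne_zero
    push_cast
    field_simp
  have hH (x : ℝ) : H (x : AddCircle (2 * π)) = f (Real.cos x) := by
    change f _ = _
    rw [hexp, hexp, Complex.ofReal_cos, Complex.cos]
    simp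
  have hHneg (t : AddCircle (2 * π)) : H (-t) = H t := by
    change f _ = f _
    congr 2
    rw [add_comm]
    simp [fourier_apply]
  have hcneg (n : ℤ) : fourierCoeff H (-n) = fourierCoeff H n := by
    rw [fourierCoeff, fourierCoeff, ← MeasureTheory.integral_neg_eq_self]
    refine MeasureTheory.integral_congr_ae (.of_forall fun t => ?_)
    simp only [hHneg]
    congr 1
    simp [fourier_apply]
  have hc (n : ℕ) : ‖fourierCoeff H n‖ ≤ M * (ρ⁻¹) ^ n := by
    rw [fourierCoeff_eq_intervalIntegral _ _ 0, norm_smul, zero_add]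
    have : (∫ x in (0 : ℝ)..2 * π, fourier (-(n : ℤ)) (x : AddCircle (2 * π)) • H x) =
        ∫ x in (0 : ℝ)..2 * π, Complex.exp (-(n * x * Complex.I)) * f (Real.cos x) := by
      refine intervalIntegral.integral_congr fun x _ => ?_
      simp only [hexp, hH, smul_eq_mul]
      simp
    rw [this, Real.norm_of_nonneg (by positivity), one_div, inv_mul_le_iff₀ hT.out]
    exact norm_fourier_integral_le hf hρ hM n
  have hr : ρ⁻¹ < 1 := inv_lt_one_of_one_lt₀ hρ
  have hgeo : Summable fun n : ℕ => M * (ρ⁻¹) ^ n :=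
    (summable_geometric_of_lt_one (by positivity) hr).mul_left M
  have hs : Summable (fourierCoeff H) :=
    .of_nat_of_neg (.of_norm_bounded hgeo hc) (.of_norm_bounded hgeo fun n => by
      rw [hcneg]; exact hc n)
  let c : ℕ → ℂ := fun n => fourierCoeff H n
  refine ⟨∑ n ∈ Finset.range (N + 1), Polynomial.C (2 * (c n).re) * Chebyshev.T ℝ n
    - Polynomial.C (c 0).re, ?_, fun ω hω => ?_⟩
  · rw [natDegree_sub_C]
    refine natDegree_sum_le_of_forall_le _ _ fun n hn => ?_
    refine (natDegree_C_mul_le _ _).trans ?_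
    simp only [Chebyshev.natDegree_T, Int.natAbs_natCast]
    simpa [Nat.lt_succ_iff] using hn
  obtain ⟨θ, rfl⟩ : ∃ θ, Real.cos θ = ω := ⟨_, Real.cos_arccos hω.1 hω.2⟩
  have hsum : HasSum (fun n : ℕ => 2 * c n * Real.cos (n * θ)) (f (Real.cos θ) + c 0) := by
    have := (has_pointwise_sum_fourier_series_of_summable hs (θ : AddCircle (2 * π))).nat_add_neg
    simp only [hcneg, hH, hexp] at this
    convert! this using 1
    · ext n
      simp only [smul_eq_mul, Complex.ofReal_cos, Complex.cos, c]
      push_cast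
      ring_nf
    · simp [c]
  have hbound := norm_sub_le_of_geometric_bound_of_hasSum hr (C := 2 * M) (fun n => by
    rw [norm_mul, norm_mul, Complex.norm_real]
    have h1 : ‖Real.cos (n * θ)‖ ≤ 1 := Real.abs_cos_le_one _
    have h2 := mul_le_mul (hc n) h1 (norm_nonneg _) ((norm_nonneg _).trans (hc n))
    rw [Complex.norm_ofNat]
    linarith) hsum (N + 1)
  have hre := (Complex.abs_re_le_norm _).trans hbound
  rw [abs_sub_comm]
  convert! hre using 1
  · congr 1
    have hterm (n : ℕ) : (2 * c n * (Real.cos (n * θ) : ℂ)).re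
        = 2 * (c n).re * Real.cos (n * θ) := by
      rw [Complex.re_mul_ofReal]
      simp
    simp only [eval_sub, eval_C, eval_finsetSum, eval_mul, Chebyshev.T_real_cos,
      Int.cast_natCast, Complex.sub_re, Complex.add_re, Complex.re_sum, hterm]
    ring
  · rw [pow_succ]
    field_simp

lemma norm_cos_le_exp_abs_im (z : ℂ) : ‖Complex.cos z‖ ≤ Real.exp |z.im| := by
  have h := norm_add_le (Complex.exp (z * Complex.I)) (Complex.exp (-z * Complex.I))
  rw [Complex.norm_exp, Complex.norm_exp] at h
  have h1 : Real.exp (z * Complex.I).re ≤ Real.exp |z.im| :=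
    Real.exp_le_exp.2 (by simpa using neg_le_abs z.im)
  have h2 : Real.exp (-z * Complex.I).re ≤ Real.exp |z.im| :=
    Real.exp_le_exp.2 (by simpa using le_abs_self z.im)
  rw [Complex.cos, norm_div, Complex.norm_ofNat]
  linarith

lemma norm_sin_le_exp_norm (z : ℂ) : ‖Complex.sin z‖ ≤ Real.exp ‖z‖ := by
  have h := norm_sub_le (Complex.exp (-z * Complex.I)) (Complex.exp (z * Complex.I))
  rw [Complex.norm_exp, Complex.norm_exp] at h
  have him := Complex.abs_im_le_norm z
  have h1 : Real.exp (z * Complex.I).re ≤ Real.exp ‖z‖ :=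
    Real.exp_le_exp.2 (by simpa using (neg_le_abs z.im).trans him)
  have h2 : Real.exp (-z * Complex.I).re ≤ Real.exp ‖z‖ :=
    Real.exp_le_exp.2 (by simpa using (le_abs_self z.im).trans him)
  rw [Complex.sin, norm_div, Complex.norm_ofNat, norm_mul, Complex.norm_I]
  linarith

lemma norm_mul_cos_le {t y : ℝ} (ht : |t| ≤ 1) (hy : |y| ≤ 1) (z : ℂ) :
    ‖(t : ℂ) * Complex.cos (z * y)‖ ≤ Real.exp |z.im| := by
  rw [norm_mul, Complex.norm_real, ← one_mul (Real.exp _)]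
  refine mul_le_mul ht ((norm_cos_le_exp_abs_im _).trans (Real.exp_le_exp.2 ?_))
    (norm_nonneg _) zero_le_one
  rw [Complex.im_mul_ofReal, abs_mul]
  exact mul_le_of_le_one_right (abs_nonneg _) hy

lemma uIoc_neg_one_one_subset : uIoc (-1 : ℝ) 1 ⊆ Icc (-1) 1 := by
  rw [uIoc_of_le (by norm_num)]
  exact Ioc_subset_Icc_self

lemma differentiable_integral_mul_cos {g t : ℝ → ℝ} (hg : Measurable g) (ht : Measurable t)
    (hg1 : ∀ x ∈ Icc (-1 : ℝ) 1, |g x| ≤ 1) (ht1 : ∀ x ∈ Icc (-1 : ℝ) 1, |t x| ≤ 1) :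
    Differentiable ℂ fun z : ℂ => ∫ x in (-1 : ℝ)..1, (t x : ℂ) * Complex.cos (z * g x) := by
  intro z₀
  have hmeas (z : ℂ) : Measurable fun x : ℝ => (t x : ℂ) * Complex.cos (z * g x) := by
    fun_prop
  have hmeas' : Measurable fun x : ℝ =>
      (t x : ℂ) * (-Complex.sin (z₀ * g x) * g x) := by
    fun_prop
  refine (intervalIntegral.hasDerivAt_integral_of_dominated_loc_of_deriv_le
    (F := fun (z : ℂ) (x : ℝ) => (t x : ℂ) * Complex.cos (z * g x))
    (F' := fun (z : ℂ) (x : ℝ) => (t x : ℂ) * (-Complex.sin (z * g x) * g x))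
    (bound := fun _ => Real.exp (‖z₀‖ + 1))
    (Metric.ball_mem_nhds z₀ one_pos)
    (.of_forall fun z => (hmeas z).aestronglyMeasurable) ?_ hmeas'.aestronglyMeasurable
    (.of_forall fun x hx z hz => ?_) intervalIntegrable_const
    (.of_forall fun x _ z _ => ?_)).2.differentiableAt
  · refine (intervalIntegrable_const (c := Real.exp |z₀.im|)).mono_fun'
      (hmeas z₀).aestronglyMeasurable ?_
    refine (MeasureTheory.ae_restrict_iff' measurableSet_uIoc).2 (.of_forall fun x hx => ?_)
    exact norm_mul_cos_le (ht1 x (uIoc_neg_one_one_subset hx))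
      (hg1 x (uIoc_neg_one_one_subset hx)) z₀
  · have hx' := uIoc_neg_one_one_subset hx
    have hgx : ‖(g x : ℂ)‖ ≤ 1 := by simpa using hg1 x hx'
    have htx : ‖(t x : ℂ)‖ ≤ 1 := by simpa using ht1 x hx'
    have hz' : ‖z‖ ≤ ‖z₀‖ + 1 := by
      have := norm_le_norm_add_norm_sub' z z₀
      rw [mem_ball_iff_norm] at hz
      linarith
    have hsin : ‖Complex.sin (z * g x)‖ ≤ Real.exp (‖z₀‖ + 1) := by
      refine (norm_sin_le_exp_norm _).trans (Real.exp_le_exp.2 ?_)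
      rw [norm_mul]
      exact (mul_le_of_le_one_right (norm_nonneg _) hgx).trans hz'
    rw [norm_mul, norm_mul, norm_neg]
    calc _ ≤ 1 * (Real.exp (‖z₀‖ + 1) * 1) := by gcongr
      _ = _ := by ring
  · exact (((hasDerivAt_mul_const (g x : ℂ)).ccos).const_mul (t x : ℂ))

lemma norm_integral_mul_cos_le {g t : ℝ → ℝ}
    (hg1 : ∀ x ∈ Icc (-1 : ℝ) 1, |g x| ≤ 1) (ht1 : ∀ x ∈ Icc (-1 : ℝ) 1, |t x| ≤ 1) (z : ℂ) :
    ‖∫ x in (-1 : ℝ)..1, (t x : ℂ) * Complex.cos (z * g x)‖ ≤ 2 * Real.exp |z.im| := by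
  refine (intervalIntegral.norm_integral_le_of_norm_le_const (C := Real.exp |z.im|)
    fun x hx => ?_).trans (le_of_eq ?_)
  · exact norm_mul_cos_le (ht1 x (uIoc_neg_one_one_subset hx))
      (hg1 x (uIoc_neg_one_one_subset hx)) z
  · norm_num [mul_comm]

lemma abs_im_add_inv_le {ρ : ℝ} (hρ : 1 < ρ) {z : ℂ} (hz : ‖z‖ = ρ) :
    |(z + z⁻¹).im| ≤ ρ - ρ⁻¹ := by
  have hρ0 : 0 < ρ := by linarith
  have h1 : (z + z⁻¹).im = z.im * (1 - (ρ ^ 2)⁻¹) := by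
    rw [Complex.add_im, Complex.inv_im, Complex.normSq_eq_norm_sq, hz]
    field_simp
    ring
  have h2 : (ρ ^ 2)⁻¹ ≤ 1 := inv_le_one_of_one_le₀ (one_le_pow₀ hρ.le)
  rw [h1, abs_mul, abs_of_nonneg (sub_nonneg.2 h2)]
  calc |z.im| * (1 - (ρ ^ 2)⁻¹) ≤ ρ * (1 - (ρ ^ 2)⁻¹) :=
        mul_le_mul_of_nonneg_right (hz ▸ Complex.abs_im_le_norm z) (sub_nonneg.2 h2)
    _ = ρ - ρ⁻¹ := by field_simp

/-- Polynomial approximation of the prototype function `ω ↦ ∫_{-1}^1 T_k(x) cos(ω g(x)) dx`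
on `[ω_min, ω_max]` (analytic core of Theorem 4.4): for
`N ≥ ln(4M₀/(e-1)) + ln(1/ε)` with `M₀ = 2 exp(C (ω_max - ω_min))`,
`C = (1/4)√((e + e⁻¹)² - 4)`, there is a polynomial of degree at most `N` approximating
the (rescaled) prototype function uniformly to accuracy `ε`. -/
theorem prototype_polynomial_approximation (g : ℝ → ℝ) (hg : Measurable g)
    (hg1 : ∀ x ∈ Set.Icc (-1 : ℝ) 1, |g x| ≤ 1) (k : ℕ)
    (ωmin ωmax : ℝ) (hω : ωmin < ωmax)
    (ε : ℝ) (hε0 : 0 < ε) (hε1 : ε < 1)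
    (C M₀ : ℝ)
    (hC : C = (1 / 4) * Real.sqrt ((Real.exp 1 + (Real.exp 1)⁻¹) ^ 2 - 4))
    (hM₀ : M₀ = 2 * Real.exp (C * (ωmax - ωmin)))
    (N : ℕ) (hN : Real.log (4 * M₀ / (Real.exp 1 - 1)) + Real.log (1 / ε) ≤ N) :
    ∃ p : Polynomial ℝ, p.natDegree ≤ N ∧
      ∀ ω ∈ Set.Icc (-1 : ℝ) 1,
        |(∫ x in (-1 : ℝ)..1,
            (Polynomial.Chebyshev.T ℝ k).eval x *
              Real.cos ((((ωmax - ωmin) / 2) * ω + (ωmax + ωmin) / 2) * g x)) - p.eval ω| ≤ ε := by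
  have he : 1 < Real.exp 1 := Real.one_lt_exp_iff.2 one_pos
  have he1 : 0 < Real.exp 1 - 1 := by linarith
  have hC' : C = (Real.exp 1 - (Real.exp 1)⁻¹) / 4 := by
    have h0 : 0 ≤ Real.exp 1 - (Real.exp 1)⁻¹ := by
      have := inv_lt_one_of_one_lt₀ he
      linarith
    have h1 : (Real.exp 1 + (Real.exp 1)⁻¹) ^ 2 - 4 = (Real.exp 1 - (Real.exp 1)⁻¹) ^ 2 := by
      field_simp
      ring
    rw [hC, h1, Real.sqrt_sq h0]
    ring
  have hM0 : 0 < M₀ := by rw [hM₀]; positivity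
  have ht1 : ∀ x ∈ Icc (-1 : ℝ) 1, |(Chebyshev.T ℝ k).eval x| ≤ 1 :=
    fun x hx => Chebyshev.abs_eval_T_real_le_one k (abs_le.2 hx)
  have ht : Measurable fun x : ℝ => (Chebyshev.T ℝ k).eval x := by fun_prop
  obtain ⟨p, hp, hpω⟩ := exists_polynomial_abs_re_sub_le_of_bernstein_ellipse
    (f := fun z : ℂ => ∫ x in (-1 : ℝ)..1, (((Chebyshev.T ℝ k).eval x : ℝ) : ℂ) *
      Complex.cos (((((ωmax - ωmin) / 2 : ℝ) : ℂ) * z + ((ωmax + ωmin) / 2 : ℝ)) * g x))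
    ((differentiable_integral_mul_cos hg ht hg1 ht1).comp
      ((differentiable_id.const_mul _).add_const _)) he (M := M₀)
    (fun z hz => by
      refine (norm_integral_mul_cos_le hg1 ht1 _).trans ?_
      rw [hM₀]
      gcongr
      have h1 := abs_im_add_inv_le he hz
      have h2 : ((((ωmax - ωmin) / 2 : ℝ) : ℂ) * ((z + z⁻¹) / 2) +
          (((ωmax + ωmin) / 2 : ℝ) : ℂ)).im = (ωmax - ωmin) / 4 * (z + z⁻¹).im := by
        rw [Complex.add_im, Complex.ofReal_im, Complex.im_ofReal_mul, Complex.div_ofNat_im]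
        ring
      rw [h2, abs_mul, abs_of_nonneg (by linarith), hC']
      calc _ ≤ (ωmax - ωmin) / 4 * (Real.exp 1 - (Real.exp 1)⁻¹) := by
            gcongr
        _ = _ := by ring) N
  refine ⟨p, hp, fun ω hω' => ?_⟩
  have h := hpω ω hω'
  have hcast : (∫ x in (-1 : ℝ)..1, (((Chebyshev.T ℝ k).eval x : ℝ) : ℂ) *
      Complex.cos (((((ωmax - ωmin) / 2 : ℝ) : ℂ) * ω + ((ωmax + ωmin) / 2 : ℝ)) * g x)) =
      ((∫ x in (-1 : ℝ)..1, (Chebyshev.T ℝ k).eval x *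
        Real.cos ((((ωmax - ωmin) / 2) * ω + (ωmax + ωmin) / 2) * g x) : ℝ) : ℂ) := by
    rw [← intervalIntegral.integral_ofReal]
    push_cast
    rfl
  rw [hcast, Complex.ofReal_re] at h
  refine h.trans ?_
  have hN' : 4 * M₀ / (Real.exp 1 - 1) * (1 / ε) ≤ Real.exp 1 ^ N := by
    rw [← Real.log_mul (by positivity) (by positivity), Real.log_le_iff_le_exp (by positivity)] at hN
    simpa using hN
  rw [div_mul_div_comm, div_le_iff₀ (by positivity)] at hN'
  rw [div_le_iff₀ he1, inv_pow, ← div_eq_mul_inv, div_le_iff₀ (by positivity)]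
  linarith
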